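/- arXiv:2204.12545 — 2 statements merged into one kernel-verified Lean document; each statement's English description precedes it below -/
import Mathlib

section
/- Let G be a non-elementary hyperbolic group and d, d' two left-invariant hyperbolic pseudometrics on G quasi-isometric to word metrics. Then for every ε ∈ (0,1) there exists C' ≥ 0 such that for all x,y ∈ G: (1−ε)·Dil(d',d)^{-1}·d'(x,y) − C' ≤ d(x,y) ≤ (1−ε)^{-1}·Dil(d,d')·d'(x,y) + C', where Dil(d,d') = sup_x ℓ_d(x)/ℓ_{d'}(x), the supremum over infinite-order elements x. -/
open Filter Set MeasureTheory Topology

noncomputable section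

variable {X : Type*}

/-- The Gromov product `(x|y)_w` with respect to `d`. -/
def gp (d : X → X → ℝ) (w x y : X) : ℝ := (d x w + d y w - d x y) / 2

/-- `d` is a pseudometric. -/
def IsPseudometric (d : X → X → ℝ) : Prop :=
  (∀ x, d x x = 0) ∧ (∀ x y, d x y = d y x) ∧ (∀ x y z, d x z ≤ d x y + d y z)

/-- `d` is `δ`-hyperbolic: the four-point Gromov product condition. -/
def GromovHyperbolic (d : X → X → ℝ) (δ : ℝ) : Prop :=
  ∀ x y z w, min (gp d w x y) (gp d w y z) - δ ≤ gp d w x z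

/-- `d` is `α`-rough geodesic: any two points are joined by an `α`-rough geodesic. -/
def RoughGeodesic (d : X → X → ℝ) (α : ℝ) : Prop :=
  ∀ x y : X, ∃ (n : ℕ) (γ : ℕ → X), γ 0 = x ∧ γ n = y ∧
    ∀ i j : ℕ, i ≤ n → j ≤ n →
      |(i : ℝ) - (j : ℝ)| - α ≤ d (γ i) (γ j) ∧ d (γ i) (γ j) ≤ |(i : ℝ) - (j : ℝ)| + α

variable {G : Type*} [Group G]

/-- Left invariance of a pseudometric on a group. -/
def LeftInvariant (d : G → G → ℝ) : Prop := ∀ g x y : G, d (g * x) (g * y) = d x y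

/-- Word norm with respect to a subset `S`. -/
def wordNorm (S : Set G) (w : G) : ℕ :=
  sInf {k : ℕ | ∃ f : Fin k → G, (∀ i, f i ∈ S) ∧ (List.ofFn f).prod = w}

/-- Word metric with respect to a subset `S`. -/
def wordDist (S : Set G) (x y : G) : ℝ := (wordNorm S (x⁻¹ * y) : ℝ)

/-- `S` is a symmetric generating set. -/
def GenSymm (S : Set G) : Prop := (∀ s ∈ S, s⁻¹ ∈ S) ∧ Subgroup.closure S = ⊤

/-- `d'` is quasi-isometric to `d` (via the identity map of `G`). -/
def QIsometric (d d' : G → G → ℝ) : Prop :=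
  ∃ l1 l2 e : ℝ, 0 < l1 ∧ 0 < l2 ∧ 0 ≤ e ∧
    ∀ x y : G, d x y / l1 - e ≤ d' x y ∧ d' x y ≤ l2 * d x y + e

/-- Membership in `D(G)`: a left-invariant hyperbolic pseudometric on `G`
quasi-isometric to a word metric w.r.t. a finite symmetric generating set. -/
def InD (d : G → G → ℝ) : Prop :=
  IsPseudometric d ∧ LeftInvariant d ∧ (∃ δ ≥ (0 : ℝ), GromovHyperbolic d δ) ∧
    ∃ S : Finset G, GenSymm (S : Set G) ∧ QIsometric (wordDist (S : Set G)) d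

/-- `G` is a hyperbolic group: some word metric is Gromov hyperbolic. -/
def IsHyperbolicGroup (G : Type*) [Group G] : Prop :=
  ∃ S : Finset G, GenSymm (S : Set G) ∧ ∃ δ ≥ (0 : ℝ), GromovHyperbolic (wordDist (S : Set G)) δ

/-- `G` is non-elementary: it is not virtually abelian. -/
def NonElementary (G : Type*) [Group G] : Prop :=
  ¬ ∃ H : Subgroup G, H.FiniteIndex ∧ ∀ a ∈ H, ∀ b ∈ H, a * b = b * a

/-- Translation length `ℓ_d(x) = lim_n d(x^n,1)/n`; by Fekete's subadditivity lemma the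
limit exists and equals the infimum of `d(x^n,1)/n` over `n ≥ 1`. -/
def tlen (d : G → G → ℝ) (x : G) : ℝ :=
  sInf {r : ℝ | ∃ n : ℕ, r = d (x ^ (n + 1)) 1 / (n + 1)}

/-- Dilation `Dil(d,d') = sup_x ℓ_d(x)/ℓ_{d'}(x)` over infinite-order elements. -/
def Dil (d d' : G → G → ℝ) : ℝ :=
  sSup {r : ℝ | ∃ x : G, ¬ IsOfFinOrder x ∧ r = tlen d x / tlen d' x}

/-- Critical exponent `h(d) = lim_n log|B_d(n)|/n` (the limit exists, so it equals
the limsup used here). -/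
def hCrit (d : G → G → ℝ) : ℝ :=
  Filter.limsup (fun n : ℕ => Real.log (Set.ncard {x : G | d x 1 ≤ (n : ℝ)}) / (n : ℝ)) atTop

/-- `Λ(d1,d2)`: the infimum of `λ1·λ2` over quasi-isometry constants between `d1,d2`. -/
def Lam (d1 d2 : G → G → ℝ) : ℝ :=
  sInf {l : ℝ | ∃ l1 l2 A : ℝ, 0 < l1 ∧ 0 < l2 ∧ 0 ≤ A ∧ l = l1 * l2 ∧
    ∀ x y : G, d2 x y / l1 - A ≤ d1 x y ∧ d1 x y ≤ l2 * d2 x y + A}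


theorem pm_nonneg {d : G → G → ℝ} (h : IsPseudometric d) (x y : G) : 0 ≤ d x y := by
  obtain ⟨h0, hs, ht⟩ := h
  have := ht x y x
  rw [h0, hs y x] at this
  linarith

theorem exists_word {S : Set G} (hS : GenSymm S) (g : G) :
    ∃ l : List G, (∀ s ∈ l, s ∈ S) ∧ l.prod = g ∧ l.length = wordNorm S g := by
  have hne : {k : ℕ | ∃ f : Fin k → G, (∀ i, f i ∈ S) ∧ (List.ofFn f).prod = g}.Nonempty := by
    have hg : g ∈ Subgroup.closure S := by rw [hS.2]; trivial
    rw [← Subgroup.mem_toSubmonoid, Subgroup.closure_toSubmonoid] at hg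
    obtain ⟨l, hl, hp⟩ := Submonoid.exists_list_of_mem_closure hg
    refine ⟨l.length, l.get, ?_, ?_⟩
    · intro i
      rcases hl _ (l.get_mem i) with h | h
      · exact h
      · simpa using hS.1 _ h
    · rw [List.ofFn_get, hp]
  obtain ⟨f, hf, hp⟩ := Nat.sInf_mem hne
  refine ⟨List.ofFn f, ?_, hp, ?_⟩
  · intro s hs
    obtain ⟨i, rfl⟩ := (List.mem_ofFn' f s).1 hs
    exact hf i
  · rw [List.length_ofFn]; rfl

theorem d_list_le {d : G → G → ℝ} (h : IsPseudometric d) (hL : LeftInvariant d)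
    {S : Set G} {c : ℝ} (hc : ∀ s ∈ S, d s 1 ≤ c) (l : List G) (hl : ∀ s ∈ l, s ∈ S) :
    d l.prod 1 ≤ c * l.length := by
  induction l with
  | nil => simp [h.1]
  | cons a l ih =>
    have h1 := ih (fun s hs => hl s (List.mem_cons_of_mem _ hs))
    have h2 := hc a (hl a List.mem_cons_self)
    have h3 := h.2.2 (a * l.prod) a 1
    have h4 := hL a l.prod 1
    rw [mul_one] at h4
    simp only [List.prod_cons, List.length_cons]
    push_cast
    linarith

theorem fin_bound (d : G → G → ℝ) (S : Finset G) : ∃ c : ℝ, 0 ≤ c ∧ ∀ s ∈ S, d s 1 ≤ c := by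
  obtain ⟨c, hc⟩ := (S.finite_toSet.image (fun s => d s 1)).bddAbove
  exact ⟨max c 0, le_max_right _ _, fun s hs => le_max_of_le_left (hc ⟨s, hs, rfl⟩)⟩

/-- Data extracted from `InD`: word norm controlled by `d`. -/
theorem word_le {d : G → G → ℝ} (hd : InD d) : ∃ S : Finset G, GenSymm (S : Set G) ∧
    ∃ A B : ℝ, 0 < A ∧ 0 ≤ B ∧ ∀ g : G, (wordNorm (S : Set G) g : ℝ) ≤ A * d g 1 + B := by
  obtain ⟨hp, hL, -, S, hS, l1, l2, e, h1, h2, he, hq⟩ := hd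
  refine ⟨S, hS, l1, l1 * e, h1, by positivity, fun g => ?_⟩
  have := (hq 1 g).1
  simp only [wordDist, inv_one, one_mul] at this
  rw [hp.2.1 1 g, sub_le_iff_le_add, div_le_iff₀ h1] at this
  linarith

theorem ball_finite {d : G → G → ℝ} (hd : InD d) (R : ℝ) : {g : G | d g 1 ≤ R}.Finite := by
  obtain ⟨S, hS, A, B, hA, hB, h⟩ := word_le hd
  obtain ⟨N, hN⟩ := exists_nat_ge (A * R + B)
  have hfin : (⋃ k ∈ Finset.range (N + 1),
      Set.range (fun f : Fin k → S => (List.ofFn (fun i => (f i : G))).prod)).Finite := by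
    refine Set.Finite.biUnion (Finset.finite_toSet _) (fun k _ => Set.finite_range _)
  refine hfin.subset ?_
  intro g hg
  obtain ⟨l, hl, hp, hlen⟩ := exists_word hS g
  have h1 := h g
  have h2 : A * d g 1 ≤ A * R := mul_le_mul_of_nonneg_left hg hA.le
  have h3 : wordNorm (S : Set G) g ≤ N := by
    have : (wordNorm (S : Set G) g : ℝ) ≤ N := by linarith
    exact_mod_cast this
  simp only [Set.mem_iUnion, Finset.mem_range]
  refine ⟨l.length, by omega, fun i => ⟨l.get i, hl _ (l.get_mem i)⟩, ?_⟩
  simp only [List.ofFn_get, hp]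

theorem d_le_lin {d d' : G → G → ℝ} (hd : InD d) (hd' : InD d') :
    ∃ L C : ℝ, 0 ≤ L ∧ 0 ≤ C ∧ ∀ g : G, d g 1 ≤ L * d' g 1 + C := by
  obtain ⟨S, hS, A, B, hA, hB, h⟩ := word_le hd'
  obtain ⟨c, hc0, hc⟩ := fin_bound d S
  refine ⟨c * A, c * B, by positivity, by positivity, fun g => ?_⟩
  obtain ⟨l, hl, hp, hlen⟩ := exists_word hS g
  have h1 := d_list_le hd.1 hd.2.1 (fun s hs => hc s hs) l hl
  rw [hp, hlen] at h1
  have := mul_le_mul_of_nonneg_left (h g) hc0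
  linarith

/-! Translation length -/

theorem tlen_le {d : G → G → ℝ} (hd : IsPseudometric d) (x : G) (n : ℕ) :
    tlen d x ≤ d (x ^ (n + 1)) 1 / (n + 1) := by
  refine csInf_le ⟨0, ?_⟩ ⟨n, rfl⟩
  rintro r ⟨m, rfl⟩
  have := pm_nonneg hd (x ^ (m + 1)) 1
  positivity

theorem le_tlen {d : G → G → ℝ} {x : G} {t : ℝ}
    (h : ∀ n : ℕ, t ≤ d (x ^ (n + 1)) 1 / (n + 1)) : t ≤ tlen d x := by
  refine le_csInf ⟨_, 0, rfl⟩ ?_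
  rintro r ⟨m, rfl⟩
  exact h m

theorem tlen_nonneg {d : G → G → ℝ} (hd : IsPseudometric d) (x : G) : 0 ≤ tlen d x := by
  refine le_tlen (fun m => ?_)
  have := pm_nonneg hd (x ^ (m + 1)) 1
  positivity

theorem tlen_fin {d : G → G → ℝ} (hd : IsPseudometric d) (x : G) (hx : IsOfFinOrder x) :
    tlen d x = 0 := by
  refine le_antisymm ?_ (tlen_nonneg hd x)
  obtain ⟨n, hn, hx⟩ := isOfFinOrder_iff_pow_eq_one.1 hx
  have := tlen_le hd x (n - 1)
  rw [Nat.sub_add_cancel hn, hx, hd.1] at this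
  simpa using this

theorem d_pow_le {d : G → G → ℝ} (h : IsPseudometric d) (hL : LeftInvariant d) (x : G) (j : ℕ) :
    d (x ^ j) 1 ≤ j * d x 1 := by
  induction j with
  | zero => simp [h.1]
  | succ j ih =>
    have h3 := h.2.2 (x ^ j * x) (x ^ j) 1
    have h4 := hL (x ^ j) x 1
    rw [mul_one] at h4
    rw [pow_succ]; push_cast
    linarith

theorem tlen_le_lin {d d' : G → G → ℝ} (hd : InD d) (hd' : InD d') {L C : ℝ}
    (hL : 0 ≤ L) (h : ∀ g : G, d g 1 ≤ L * d' g 1 + C) (x : G) :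
    tlen d x ≤ L * tlen d' x := by
  have key : ∀ m : ℕ, tlen d x ≤ L * (d' (x ^ (m + 1)) 1 / (m + 1)) := by
    intro m
    have hm : (0 : ℝ) < m + 1 := by positivity
    have step : ∀ j : ℕ, tlen d x ≤
        L * (d' (x ^ (m + 1)) 1 / (m + 1)) + (C / (m + 1)) * (1 / ((j : ℝ) + 1)) := by
      intro j
      have hj : (0 : ℝ) < j + 1 := by positivity
      have h1 := tlen_le hd.1 x ((m + 1) * (j + 1) - 1)
      have e1 : (m + 1) * (j + 1) - 1 + 1 = (m + 1) * (j + 1) :=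
        Nat.sub_add_cancel (Nat.mul_pos (Nat.succ_pos _) (Nat.succ_pos _))
      have e2 : (((m + 1) * (j + 1) - 1 : ℕ) : ℝ) + 1 = (m + 1) * (j + 1) := by
        exact_mod_cast e1
      rw [e1, e2, pow_mul] at h1
      have h2 := h ((x ^ (m + 1)) ^ (j + 1))
      have h3 := d_pow_le hd'.1 hd'.2.1 (x ^ (m + 1)) (j + 1)
      push_cast at h3
      have h4 := mul_le_mul_of_nonneg_left h3 hL
      refine h1.trans ?_
      rw [div_le_iff₀ (by positivity)]
      have e3 : (L * (d' (x ^ (m + 1)) 1 / (m + 1)) + (C / (m + 1)) * (1 / ((j : ℝ) + 1))) *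
          ((m + 1) * (j + 1)) = L * ((j + 1) * d' (x ^ (m + 1)) 1) + C := by
        field_simp
      rw [e3]; linarith
    have lim : Tendsto (fun j : ℕ => L * (d' (x ^ (m + 1)) 1 / (m + 1)) +
        (C / (m + 1)) * (1 / ((j : ℝ) + 1))) atTop
        (𝓝 (L * (d' (x ^ (m + 1)) 1 / (m + 1)) + (C / (m + 1)) * 0)) :=
      (tendsto_one_div_add_atTop_nhds_zero_nat.const_mul _).const_add _
    have := ge_of_tendsto' lim step
    simpa using this
  rcases hL.eq_or_lt with h0 | h0
  · have := key 0
    rw [← h0] at this ⊢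
    simpa using this
  · rw [← div_le_iff₀' h0]
    refine le_tlen (fun m => ?_)
    rw [div_le_iff₀' h0]
    exact key m

theorem Dil_nonneg {d d' : G → G → ℝ} (hd : InD d) (hd' : InD d') : 0 ≤ Dil d d' := by
  refine Real.sSup_nonneg ?_
  rintro r ⟨x, -, rfl⟩
  exact div_nonneg (tlen_nonneg hd.1 x) (tlen_nonneg hd'.1 x)

theorem tlen_le_Dil {d d' : G → G → ℝ} (hd : InD d) (hd' : InD d') (x : G) :
    tlen d x ≤ Dil d d' * tlen d' x := by
  obtain ⟨L, C, hL, hC, h⟩ := d_le_lin hd hd'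
  have hlin := tlen_le_lin hd hd' hL h
  by_cases hx : IsOfFinOrder x
  · rw [tlen_fin hd.1 x hx, tlen_fin hd'.1 x hx]; simp
  rcases (tlen_nonneg hd'.1 x).eq_or_lt with h0 | h0
  · have := hlin x
    rw [← h0] at this ⊢
    simpa using this
  · rw [← div_le_iff₀ h0]
    refine le_csSup ⟨L, ?_⟩ ⟨x, hx, rfl⟩
    rintro r ⟨z, -, rfl⟩
    rcases (tlen_nonneg hd'.1 z).eq_or_lt with h1 | h1
    · rw [← h1]; simpa using hL
    · rw [div_le_iff₀ h1]; exact hlin z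

theorem tlen_lower {d : G → G → ℝ} (h : IsPseudometric d) (hL : LeftInvariant d) {δ : ℝ}
    (hδ0 : 0 ≤ δ) (hδ : GromovHyperbolic d δ) (x : G) :
    d (x ^ 2) 1 - d x 1 - 2 * δ ≤ tlen d x := by
  set t := d (x ^ 2) 1 - d x 1 - 2 * δ with ht
  rcases le_or_gt t 0 with h0 | h0
  · exact h0.trans (tlen_nonneg h x)
  have a2 : d (x ^ 2) 1 ≤ 2 * d x 1 := by simpa using d_pow_le h hL x 2
  have step : ∀ n : ℕ, d (x ^ (n + 1)) 1 + t ≤ d (x ^ (n + 2)) 1 := by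
    intro n
    induction n with
    | zero => simp only [zero_add, pow_one]; linarith
    | succ n ih =>
      have hh := hδ 1 (x ^ (n + 3)) (x ^ 2) x
      simp only [gp] at hh
      have e1 : d (x ^ (n + 3)) x = d (x ^ (n + 2)) 1 := by
        have := hL x (x ^ (n + 2)) 1
        rwa [mul_one, ← pow_succ'] at this
      have e2 : d (x ^ 2) x = d x 1 := by
        have := hL x x 1
        rwa [mul_one, ← pow_two] at this
      have e3 : d (x ^ (n + 3)) (x ^ 2) = d (x ^ (n + 1)) 1 := by
        have := hL (x ^ 2) (x ^ (n + 1)) 1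
        rwa [mul_one, ← pow_add, show 2 + (n + 1) = n + 3 by ring] at this
      rw [h.2.1 1 x, e1, e2, e3, h.2.1 1, h.2.1 1] at hh
      change d (x ^ (n + 2)) 1 + t ≤ d (x ^ (n + 3)) 1
      by_contra hcon
      push Not at hcon
      have : (d x 1 + d (x ^ 2) 1 - 0) / 2 = (d x 1 + d (x ^ 2) 1 - 0) / 2 := rfl
      rcases min_choice ((d x 1 + d (x ^ (n + 2)) 1 - d (x ^ (n + 3)) 1) / 2)
        ((d (x ^ (n + 2)) 1 + d x 1 - d (x ^ (n + 1)) 1) / 2) with hm | hm <;>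
      · rw [hm] at hh
        linarith
  have all : ∀ n : ℕ, ((n : ℝ) + 1) * t ≤ d (x ^ (n + 1)) 1 := by
    intro n
    induction n with
    | zero => simp; linarith
    | succ n ih => have := step n; push_cast; linarith
  refine le_tlen (fun n => ?_)
  rw [le_div_iff₀ (by positivity)]
  linarith [all n]

/-! Fixed boundary points -/

/-- A horofunction that is a quasimorphism. -/
theorem exists_horo {d : G → G → ℝ} (h : IsPseudometric d) (hL : LeftInvariant d) {δ : ℝ}
    (hδ : GromovHyperbolic d δ) (y : ℕ → G)
    (hy : ∀ (n : ℕ) (u : G), d u 1 ≤ n → (n : ℝ) - δ ≤ gp d 1 (u * y n) (y n)) :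
    ∃ β : G → ℝ, β 1 = 0 ∧ (∀ g, |β g| ≤ d g 1) ∧
      (∀ u v w, min (β u + β v - d u v) (β v + β w - d v w) - 2 * δ ≤ β u + β w - d u w) ∧
      (∀ g k, |β (g * k) - β g - β k| ≤ 2 * δ) := by
  let b : ℕ → G → ℝ := fun n g => d g (y n) - d 1 (y n)
  have hb : ∀ n g, |b n g| ≤ d g 1 := by
    intro n g
    have h1 := h.2.2 g 1 (y n)
    have h2 := h.2.2 1 g (y n)
    have h3 := h.2.1 1 g
    rw [abs_le]
    constructor <;> simp only [b] <;> linarith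
  let U : Ultrafilter ℕ := Filter.hyperfilter ℕ
  have hU : (U : Filter ℕ) ≤ atTop := by
    rw [← Nat.cofinite_eq_atTop]; exact Filter.hyperfilter_le_cofinite
  have hlim : ∀ g, ∃ r : ℝ, Tendsto (fun n => b n g) U (𝓝 r) := by
    intro g
    have hc : IsCompact (Set.Icc (-d g 1) (d g 1)) := isCompact_Icc
    obtain ⟨r, -, hr⟩ := hc.ultrafilter_le_nhds (U.map (fun n => b n g)) (by
      rw [Filter.le_principal_iff]
      have hall : ∀ᶠ n in (U : Filter ℕ), b n g ∈ Set.Icc (-d g 1) (d g 1) :=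
        Filter.Eventually.of_forall (fun n => abs_le.1 (hb n g))
      exact hall)
    exact ⟨r, hr⟩
  choose β hβ using hlim
  refine ⟨β, ?_, ?_, ?_, ?_⟩
  · have : Tendsto (fun n => b n 1) U (𝓝 0) := by simp [b]
    exact tendsto_nhds_unique (hβ 1) this
  · intro g
    exact le_of_tendsto' (hβ g).abs (fun n => hb n g)
  · intro u v w
    refine le_of_tendsto_of_tendsto'
      (((((hβ u).add (hβ v)).sub_const (d u v)).min
        (((hβ v).add (hβ w)).sub_const (d v w))).sub_const (2 * δ))
      (((hβ u).add (hβ w)).sub_const (d u w)) ?_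
    intro n
    have hh := hδ u v w (y n)
    simp only [gp] at hh
    simp only [b]
    rcases min_choice ((d u (y n) + d v (y n) - d u v) / 2)
        ((d v (y n) + d w (y n) - d v w) / 2) with hm | hm
    · rw [hm] at hh
      have := min_le_left (d u (y n) - d 1 (y n) + (d v (y n) - d 1 (y n)) - d u v)
        (d v (y n) - d 1 (y n) + (d w (y n) - d 1 (y n)) - d v w)
      linarith
    · rw [hm] at hh
      have := min_le_right (d u (y n) - d 1 (y n) + (d v (y n) - d 1 (y n)) - d u v)
        (d v (y n) - d 1 (y n) + (d w (y n) - d 1 (y n)) - d v w)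
      linarith
  · intro g k
    refine le_of_tendsto (((hβ (g * k)).sub (hβ g)).sub (hβ k)).abs ?_
    obtain ⟨N, hN⟩ := exists_nat_ge (max (d g⁻¹ 1) (d k 1 + δ))
    refine hU ?_
    filter_upwards [Filter.eventually_ge_atTop N] with n hn
    have hn' : (N : ℝ) ≤ n := by exact_mod_cast hn
    have h1 : d g⁻¹ 1 ≤ n := (le_max_left _ _).trans (hN.trans hn')
    have h2 : d k 1 + δ ≤ n := (le_max_right _ _).trans (hN.trans hn')
    have h3 := hy n g⁻¹ h1
    set Y := g⁻¹ * y n with hY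
    have e1 : d (g * k) (y n) = d k Y := by
      have := hL g k Y
      rwa [hY, mul_inv_cancel_left] at this
    have e2 : d g (y n) = d 1 Y := by
      have := hL g 1 Y
      rwa [hY, mul_inv_cancel_left, mul_one] at this
    simp only [b]
    rw [e1, e2]
    have s1 := h.2.1 1 Y
    have s2 := h.2.1 1 (y n)
    have s3 := h.2.1 Y (y n)
    have q1 := hδ k Y (y n) 1
    have q2 := hδ k (y n) Y 1
    have t1 := h.2.2 1 k Y
    have t2 := h.2.2 1 k (y n)
    have t3 := h.2.1 1 k
    simp only [gp] at q1 q2 h3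
    have m1 : min ((d k 1 + d Y 1 - d k Y) / 2) ((d Y 1 + d (y n) 1 - d Y (y n)) / 2) =
        (d k 1 + d Y 1 - d k Y) / 2 := min_eq_left (by linarith)
    have m2 : min ((d k 1 + d (y n) 1 - d k (y n)) / 2)
        ((d (y n) 1 + d Y 1 - d (y n) Y) / 2) =
        (d k 1 + d (y n) 1 - d k (y n)) / 2 := min_eq_left (by linarith)
    rw [m1] at q1
    rw [m2] at q2
    rw [abs_le]
    constructor <;> linarith

/-- If the horofunction is bounded then the group is finite. -/
theorem finite_of_bdd {d : G → G → ℝ} (hd : InD d) {δ : ℝ} {β : G → ℝ} {K : ℝ} (hδ0 : 0 ≤ δ)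
    (hK : ∀ g, |β g| ≤ K)
    (hyp : ∀ u v w, min (β u + β v - d u v) (β v + β w - d v w) - 2 * δ ≤ β u + β w - d u w) :
    Finite G := by
  obtain ⟨S, hS, A, B, hA, hB, hw⟩ := word_le hd
  obtain ⟨c, hc0, hc⟩ := fin_bound d S
  have hp := hd.1
  have hL := hd.2.1
  have hK0 : 0 ≤ K := (abs_nonneg _).trans (hK 1)
  set M := 2 * δ + 4 * K with hM
  have hM0 : 0 ≤ M := by positivity
  have ultra : ∀ u v w R, d u v ≤ R → d v w ≤ R → d u w ≤ R + M := by
    intro u v w R h1 h2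
    have := hyp u v w
    have hu := abs_le.1 (hK u)
    have hv := abs_le.1 (hK v)
    have hw := abs_le.1 (hK w)
    have : -R - 2 * K ≤ min (β u + β v - d u v) (β v + β w - d v w) :=
      le_min (by linarith) (by linarith)
    linarith
  have dy : ∀ (k : ℕ) (l : List G), (∀ s ∈ l, s ∈ (S : Set G)) → l.length ≤ 2 ^ k →
      d l.prod 1 ≤ c + k * M := by
    intro k
    induction k with
    | zero =>
      intro l hl hlen
      have h1 := d_list_le hp hL (fun s hs => hc s hs) l hl
      have h2 : (l.length : ℝ) ≤ 1 := by exact_mod_cast hlen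
      have := mul_le_mul_of_nonneg_left h2 hc0
      simp; linarith
    | succ k ih =>
      intro l hl hlen
      have h1 := ih (l.take (2 ^ k)) (fun s hs => hl s (List.mem_of_mem_take hs)) (by simp)
      have h2 := ih (l.drop (2 ^ k)) (fun s hs => hl s (List.mem_of_mem_drop hs)) (by
        rw [List.length_drop]; rw [pow_succ] at hlen; omega)
      have e : (l.take (2 ^ k)).prod * (l.drop (2 ^ k)).prod = l.prod :=
        List.prod_take_mul_prod_drop l (2 ^ k)
      have h3 : d l.prod (l.take (2 ^ k)).prod ≤ c + k * M := by
        have := hL (l.take (2 ^ k)).prod (l.drop (2 ^ k)).prod 1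
        rw [mul_one, e] at this
        rw [this]; exact h2
      have := ultra _ _ _ _ h3 h1
      push_cast; linarith
  -- word norm bounded
  have hgrow : ∃ k0 : ℕ, ∀ k : ℕ, k0 ≤ k → A * (c + (k + 1) * M) + B < 2 ^ k := by
    have t1 : Tendsto (fun k : ℕ => ((k : ℝ) ^ 1) / 2 ^ k) atTop (𝓝 0) :=
      tendsto_pow_const_div_const_pow_of_one_lt 1 (by norm_num)
    have t0 : Tendsto (fun k : ℕ => ((k : ℝ) ^ 0) / 2 ^ k) atTop (𝓝 0) :=
      tendsto_pow_const_div_const_pow_of_one_lt 0 (by norm_num)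
    have t := (t1.const_mul (A * M)).add (t0.const_mul (A * c + A * M + B))
    simp only [mul_zero, add_zero] at t
    obtain ⟨k0, hk0⟩ := Filter.eventually_atTop.1 (t.eventually_lt_const (show (0 : ℝ) < 1 by norm_num))
    refine ⟨k0, fun k hk => ?_⟩
    have := hk0 k hk
    have hpos : (0 : ℝ) < 2 ^ k := by positivity
    rw [← mul_div_assoc, ← mul_div_assoc, ← add_div, div_lt_one hpos] at this
    simp only [pow_one, pow_zero, mul_one] at this
    linarith
  obtain ⟨k0, hk0⟩ := hgrow
  have hbd : ∀ g, wordNorm (S : Set G) g ≤ 2 ^ k0 := by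
    intro g
    by_contra hcon
    push Not at hcon
    obtain ⟨l, hl, hpr, hlen⟩ := exists_word hS g
    have hpos : wordNorm (S : Set G) g ≠ 0 := by
      intro h0; rw [h0] at hcon; exact Nat.not_lt_zero _ hcon
    set k := Nat.log 2 (wordNorm (S : Set G) g) with hk
    have h1 : 2 ^ k ≤ wordNorm (S : Set G) g := Nat.pow_log_le_self 2 hpos
    have h2 : wordNorm (S : Set G) g < 2 ^ (k + 1) := Nat.lt_pow_succ_log_self (by norm_num) _
    have h3 : k0 ≤ k := Nat.le_log_of_pow_le (by norm_num) hcon.le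
    have h4 := dy (k + 1) l hl (by omega)
    rw [hpr] at h4
    push_cast at h4
    have h5 := hw g
    have h6 : (2 : ℝ) ^ k ≤ wordNorm (S : Set G) g := by exact_mod_cast h1
    have h7 := mul_le_mul_of_nonneg_left h4 hA.le
    linarith [hk0 k h3]
  have : (Set.univ : Set G).Finite := by
    refine (ball_finite hd (c * 2 ^ k0)).subset ?_
    intro g _
    obtain ⟨l, hl, hpr, hlen⟩ := exists_word hS g
    have h1 := d_list_le hp hL (fun s hs => hc s hs) l hl
    rw [hpr, hlen] at h1
    have h2 : (wordNorm (S : Set G) g : ℝ) ≤ 2 ^ k0 := by exact_mod_cast hbd g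
    exact h1.trans (mul_le_mul_of_nonneg_left h2 hc0)
  exact Set.finite_univ_iff.1 this

/-- Along powers of an element that moves strongly towards the boundary point. -/
theorem ray {d : G → G → ℝ} (h : IsPseudometric d) (hL : LeftInvariant d) {δ : ℝ} {β : G → ℝ}
    (hδ0 : 0 ≤ δ) (h1 : β 1 = 0)
    (hyp : ∀ u v w, min (β u + β v - d u v) (β v + β w - d v w) - 2 * δ ≤ β u + β w - d u w)
    (hq : ∀ g k, |β (g * k) - β g - β k| ≤ 2 * δ) (g : G) (hg : β g ≤ -(3 * δ + 1)) (k : ℕ) :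
    d (g ^ k) 1 ≤ -β (g ^ k) + (d g 1 + β g + 4 * δ) ∧ β (g ^ k) ≤ -k := by
  induction k with
  | zero =>
    have hb : -β g ≤ d g 1 + 2 * δ := by
      have := hyp 1 g 1
      have h0 := h.1 1
      have hs := h.2.1 1 g
      rw [h1, h0, hs] at this
      have h3 : min (0 + β g - d g 1) (β g + 0 - d g 1) = β g - d g 1 := by simp
      rw [h3] at this
      have h4 := hyp g 1 g
      rw [h1, h.1 g, hs] at h4
      have h5 : min (β g + 0 - d g 1) (0 + β g - d g 1) = β g - d g 1 := by simp
      rw [h5] at h4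
      linarith
    simp [h.1, h1]
    linarith
  | succ k ih =>
    obtain ⟨ih1, ih2⟩ := ih
    have q := abs_le.1 (hq (g ^ k) g)
    rw [← pow_succ] at q
    have H := hyp 1 (g ^ k) (g ^ (k + 1))
    have e : d (g ^ k) (g ^ (k + 1)) = d g 1 := by
      have := hL (g ^ k) 1 g
      rw [mul_one, ← pow_succ] at this
      rw [this, h.2.1]
    rw [h1, e, h.2.1 1 (g ^ k), h.2.1 1 (g ^ (k + 1))] at H
    constructor
    · rcases min_choice (0 + β (g ^ k) - d (g ^ k) 1) (β (g ^ k) + β (g ^ (k + 1)) - d g 1)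
        with hm | hm
      · rw [hm] at H; linarith
      · rw [hm] at H; linarith
    · push_cast; linarith

theorem level_finite {d : G → G → ℝ} (hd : InD d) {δ : ℝ} {β : G → ℝ}
    (hδ0 : 0 ≤ δ) (h1 : β 1 = 0)
    (hyp : ∀ u v w, min (β u + β v - d u v) (β v + β w - d v w) - 2 * δ ≤ β u + β w - d u w)
    (hq : ∀ g k, |β (g * k) - β g - β k| ≤ 2 * δ) (g : G) (hg : β g ≤ -(3 * δ + 1)) (K : ℝ)
    (hK0 : 0 ≤ K) :
    {x : G | |β x| ≤ K}.Finite := by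
  have h := hd.1
  have hL := hd.2.1
  set c := d g 1 + β g + 4 * δ with hc
  have hray := ray h hL hδ0 h1 hyp hq g hg
  set R := 3 * K + 8 * δ + c with hR
  have key : ∀ x, |β x| ≤ K → ∃ k0 : ℕ, ∀ k ≥ k0, d ((g ^ k)⁻¹ * x * g ^ k) 1 ≤ R := by
    intro x hx
    obtain ⟨k0, hk0⟩ := exists_nat_ge (d x 1 + K)
    refine ⟨k0, fun k hk => ?_⟩
    have hk' : (k0 : ℝ) ≤ k := by exact_mod_cast hk
    obtain ⟨r1, r2⟩ := hray k
    set p := g ^ k with hp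
    have e1 : d (p⁻¹ * x * p) 1 = d p (x * p) := by
      have := hL p (p⁻¹ * x * p) 1
      rw [mul_one, mul_assoc p⁻¹, mul_inv_cancel_left] at this
      rw [mul_assoc, ← this, h.2.1]
    have e2 : d x (x * p) = d p 1 := by
      have := hL x 1 p
      rw [mul_one] at this
      rw [this, h.2.1]
    have hx' := abs_le.1 hx
    have q := abs_le.1 (hq x p)
    have c0 : 0 ≤ c := by
      have := (hray 0).1
      simp [h.1, h1] at this
      exact this
    have H1 := hyp 1 x (x * p)
    have H2 := hyp p 1 (x * p)
    rw [h1, e2, h.2.1 1 x] at H1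
    rw [h1] at H2
    have hk0p : (0 : ℝ) ≤ k := Nat.cast_nonneg k
    have m1 : 2 * β p - 2 * K - 2 * δ - c ≤
        min (0 + β x - d x 1) (β x + β (x * p) - d p 1) :=
      le_min (by linarith) (by linarith)
    have m2 : 2 * β p - 2 * K - 4 * δ - c ≤
        min (β p + 0 - d p 1) (0 + β (x * p) - d 1 (x * p)) :=
      le_min (by linarith) (by linarith)
    rw [e1]
    linarith
  by_contra hinf
  have hB := ball_finite hd R
  obtain ⟨T, hT, hcard⟩ := Set.Infinite.exists_subset_card_eq hinf (hB.toFinset.card + 1)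
  choose! f hf using key
  obtain ⟨k, hk⟩ : ∃ k, ∀ x ∈ T, f x ≤ k := ⟨T.sup f, fun x hx => Finset.le_sup hx⟩
  have := Finset.card_le_card_of_injOn (s := T) (t := hB.toFinset)
    (fun x => (g ^ k)⁻¹ * x * g ^ k) (by
      intro x hx
      simp only [Set.Finite.coe_toFinset, Set.mem_setOf_eq]
      exact hf x (hT hx) k (hk x hx)) (by
      intro x _ z _ hxz
      simpa using hxz)
  omega

theorem not_fixed {d : G → G → ℝ} (hd : InD d) (hne : NonElementary G) {δ : ℝ} {β : G → ℝ}
    (hδ0 : 0 ≤ δ) (h1 : β 1 = 0)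
    (hyp : ∀ u v w, min (β u + β v - d u v) (β v + β w - d v w) - 2 * δ ≤ β u + β w - d u w)
    (hq : ∀ g k, |β (g * k) - β g - β k| ≤ 2 * δ) : False := by
  by_cases hex : ∃ g, β g ≤ -(3 * δ + 1)
  · obtain ⟨g, hg⟩ := hex
    apply hne
    set K := -β g + 2 * δ with hK
    have hfin := level_finite hd hδ0 h1 hyp hq g hg K (by linarith)
    have red : ∀ (n : ℕ) (x : G), |β x| ≤ n → ∃ k : ℤ, |β (g ^ k * x)| ≤ K := by
      intro n
      induction n with
      | zero => intro x hx; exact ⟨0, by simp at hx; simp [hx]; linarith⟩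
      | succ n ih =>
        intro x hx
        push_cast at hx
        by_cases hxK : |β x| ≤ K
        · exact ⟨0, by simpa using hxK⟩
        have hx' := abs_le.1 hx
        rcases le_or_gt 0 (β x) with h0 | h0
        · rw [abs_of_nonneg h0] at hxK
          have q := abs_le.1 (hq g x)
          obtain ⟨k, hk⟩ := ih (g * x) (abs_le.2 ⟨by linarith, by linarith⟩)
          exact ⟨k + 1, by rwa [zpow_add_one, mul_assoc]⟩
        · rw [abs_of_neg h0] at hxK
          have q := abs_le.1 (hq g (g⁻¹ * x))
          rw [mul_inv_cancel_left] at q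
          obtain ⟨k, hk⟩ := ih (g⁻¹ * x) (abs_le.2 ⟨by linarith, by linarith⟩)
          exact ⟨k - 1, by rwa [zpow_sub_one, mul_assoc]⟩
    refine ⟨Subgroup.zpowers g, ?_, ?_⟩
    · have hs : Function.Surjective (fun f : {x : G | |β x| ≤ K} =>
          (((f : G)⁻¹ : G) : G ⧸ Subgroup.zpowers g)) := by
        intro z
        induction z using QuotientGroup.induction_on with
        | H z =>
          obtain ⟨n, hn⟩ := exists_nat_ge |β z⁻¹|
          obtain ⟨k, hk⟩ := red n z⁻¹ hn
          refine ⟨⟨_, hk⟩, ?_⟩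
          rw [QuotientGroup.eq]
          simp only [inv_inv]
          rw [mul_assoc, inv_mul_cancel, mul_one]
          exact ⟨k, rfl⟩
      haveI := hfin.to_subtype
      haveI := Finite.of_surjective _ hs
      exact Subgroup.finiteIndex_of_finite_quotient
    · rintro a ⟨i, rfl⟩ b ⟨j, rfl⟩
      simp only [← zpow_add, add_comm]
  · push Not at hex
    have hb : ∀ g, |β g| ≤ 5 * δ + 1 := by
      intro g
      have a1 := hex g
      have a2 := hex g⁻¹
      have q := abs_le.1 (hq g g⁻¹)
      rw [mul_inv_cancel, h1] at q
      exact abs_le.2 ⟨by linarith, by linarith⟩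
    haveI := finite_of_bdd hd hδ0 hb hyp
    apply hne
    refine ⟨⊥, inferInstance, ?_⟩
    intro a ha b hb
    rw [Subgroup.mem_bot] at ha hb
    rw [ha, hb]

theorem separate {d : G → G → ℝ} (hd : InD d) (hne : NonElementary G) :
    ∃ (U : Finset G) (C : ℝ), ∀ x y : G, ∃ u ∈ U, gp d 1 x (u * y) ≤ C := by
  obtain ⟨h, hL, ⟨δ, hδ0, hδ⟩, -⟩ := id hd
  by_contra hcon
  push Not at hcon
  have hsel : ∀ n : ℕ, ∃ x y : G, ∀ u, d u 1 ≤ n → (n : ℝ) < gp d 1 x (u * y) := by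
    intro n
    obtain ⟨x, y, hxy⟩ := hcon (ball_finite hd n).toFinset n
    exact ⟨x, y, fun u hu => hxy u (by simpa using hu)⟩
  choose x y hxy using hsel
  obtain ⟨β, b1, -, b3, b4⟩ := exists_horo h hL hδ y (by
    intro n u hu
    have q1 := hxy n u hu
    have q2 := hxy n 1 (by rw [h.1]; exact Nat.cast_nonneg n)
    rw [one_mul] at q2
    have q3 := hδ (u * y n) (x n) (y n) 1
    have e : gp d 1 (u * y n) (x n) = gp d 1 (x n) (u * y n) := by
      simp only [gp]; rw [h.2.1 (u * y n) (x n)]; ring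
    rw [e] at q3
    have := le_min q1.le q2.le
    linarith)
  exact not_fixed hd hne hδ0 b1 b3 b4

theorem upper {d d' : G → G → ℝ} (hne : NonElementary G) (hd : InD d) (hd' : InD d') :
    ∃ C : ℝ, 0 ≤ C ∧ ∀ x y : G, d x y ≤ Dil d d' * d' x y + C := by
  obtain ⟨h, hL, ⟨δ, hδ0, hδ⟩, -⟩ := id hd
  have h' := hd'.1
  have hL' := hd'.2.1
  obtain ⟨U, C, hU⟩ := separate hd hne
  obtain ⟨c, hc0, hc⟩ := fin_bound d U
  obtain ⟨c', hc0', hc'⟩ := fin_bound d' U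
  have hD := Dil_nonneg hd hd'
  have main : ∀ x : G, d x 1 ≤ Dil d d' * d' x 1 +
      (Dil d d' * c' + 2 * |C| + 2 * δ + 3 * c) := by
    intro x
    obtain ⟨u, hu, hux⟩ := hU x x⁻¹
    have i : ∀ {f : G → G → ℝ}, IsPseudometric f → LeftInvariant f →
        f x (x * u⁻¹) = f u 1 := by
      intro f hf hfL
      have e1 := hfL x 1 u⁻¹
      have e2 := hfL u 1 u⁻¹
      rw [mul_one] at e1 e2
      rw [mul_inv_cancel] at e2
      rw [e1, ← e2]
    have i1 := i h hL
    have i2 := i h' hL'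
    set z := x * u⁻¹ with hz
    have ez : u * x⁻¹ = z⁻¹ := by simp [hz]
    rw [ez] at hux
    have t1 := tlen_lower h hL hδ0 hδ z
    have t2 := tlen_le_Dil hd hd' z
    have t3 : tlen d' z ≤ d' z 1 := by simpa using tlen_le h' z 0
    have t4 := h'.2.2 z x 1
    rw [h'.2.1 z x, i2] at t4
    have t5 := hc' u hu
    have t6 := hc u hu
    have t7 : tlen d z ≤ Dil d d' * (d' x 1 + c') :=
      t2.trans (mul_le_mul_of_nonneg_left (by linarith) hD)
    have e2 : d (z ^ 2) 1 = d z z⁻¹ := by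
      have := hL z z z⁻¹
      rwa [mul_inv_cancel, ← pow_two] at this
    have e3 : d z⁻¹ 1 = d z 1 := by
      have := hL z z⁻¹ 1
      rw [mul_inv_cancel, mul_one] at this
      rw [← this, h.2.1]
    simp only [gp] at hux
    have s1 := h.2.2 x z z⁻¹
    have s2 := h.2.2 x z 1
    have s3 := le_abs_self C
    rw [i1] at s1 s2
    linarith
  refine ⟨Dil d d' * c' + 2 * |C| + 2 * δ + 3 * c, by positivity, fun x y => ?_⟩
  have e1 := hL y⁻¹ x y
  have e2 := hL' y⁻¹ x y
  rw [inv_mul_cancel] at e1 e2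
  rw [← e1, ← e2]
  exact main _

/-- For `d, d' ∈ D(G)` and every `ε ∈ (0,1)` there is `C' ≥ 0` with
`(1−ε)·Dil(d',d)⁻¹·d' − C' ≤ d ≤ (1−ε)⁻¹·Dil(d,d')·d' + C'`. -/
theorem dilation_quasi_isometry (G : Type*) [Group G]
    (hG : IsHyperbolicGroup G) (hne : NonElementary G)
    (d d' : G → G → ℝ) (hd : InD d) (hd' : InD d') :
    ∀ ε : ℝ, 0 < ε → ε < 1 → ∃ C' : ℝ, 0 ≤ C' ∧ ∀ x y : G,
      (1 - ε) * (Dil d' d)⁻¹ * d' x y - C' ≤ d x y ∧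
        d x y ≤ (1 - ε)⁻¹ * Dil d d' * d' x y + C' := by
  intro ε hε0 hε1
  obtain ⟨C₁, hC₁, h₁⟩ := upper hne hd hd'
  obtain ⟨C₂, hC₂, h₂⟩ := upper hne hd' hd
  have hD₁ := Dil_nonneg hd hd'
  have hD₂ := Dil_nonneg hd' hd
  refine ⟨C₁ + (1 - ε) * (Dil d' d)⁻¹ * C₂, ?_, fun x y => ⟨?_, ?_⟩⟩
  · have : 0 ≤ 1 - ε := by linarith
    positivity
  · have hn := pm_nonneg hd.1 x y
    rcases hD₂.eq_or_lt with h0 | h0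
    · rw [← h0]; simp; linarith
    · have h3 : (Dil d' d)⁻¹ * (d' x y - C₂) ≤ d x y := by
        rw [inv_mul_le_iff₀ h0]; linarith [h₂ x y]
      have h4 := mul_le_mul_of_nonneg_left h3 (show 0 ≤ 1 - ε by linarith)
      nlinarith
  · have hn := pm_nonneg hd'.1 x y
    have h3 : 1 ≤ (1 - ε)⁻¹ := (one_le_inv₀ (by linarith)).2 (by linarith)
    have h4 : 0 ≤ (1 - ε) * (Dil d' d)⁻¹ * C₂ := by
      have : 0 ≤ 1 - ε := by linarith
      positivity
    have h5 := mul_le_mul_of_nonneg_right h3 (mul_nonneg hD₁ hn)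
    have h6 := h₁ x y
    rw [mul_assoc]
    linarith

end
end

section
/- Let G be a non-elementary hyperbolic group and d1, d2 ∈ D(G). Then the pointwise sum d1 + d2 is again a left-invariant hyperbolic pseudometric on G quasi-isometric to a word metric, i.e. d1 + d2 ∈ D(G). -/
open Filter Set MeasureTheory Topology

noncomputable section

variable {X : Type*}

variable {G : Type*} [Group G]

/-! ### Auxiliary lemmas -/

theorem aux_fp {d : X → X → ℝ} {δ : ℝ} (h : GromovHyperbolic d δ) (x y z w : X) :
    d x z + d y w ≤ d x y + d z w + 2 * δ ∨ d x z + d y w ≤ d y z + d x w + 2 * δ := by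
  have h0 := h x y z w
  unfold gp at h0
  rcases min_choice ((d x w + d y w - d x y) / 2) ((d y w + d z w - d y z) / 2) with h1 | h1
  · rw [h1] at h0; left; linarith
  · rw [h1] at h0; right; linarith

theorem aux_nonneg {d : X → X → ℝ} (h : IsPseudometric d) (x y : X) : 0 ≤ d x y := by
  obtain ⟨h0, hs, ht⟩ := h
  have := ht x y x
  rw [h0, hs y x] at this
  linarith

theorem aux_log {d : X → X → ℝ} {δ : ℝ} (hp : IsPseudometric d) (hδ : 0 ≤ δ) (f : X → ℝ)
    (hf : ∀ p q r, d p r + f q ≤ d p q + f r + 2 * δ ∨ d p r + f q ≤ d q r + f p + 2 * δ)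
    (n : ℕ) (p : ℕ → X) (K R : ℝ) (hK : 0 ≤ K) (hR : ∀ i ≤ n, R ≤ f (p i))
    (hstep : ∀ i < n, d (p i) (p (i + 1)) ≤ K) :
    ∀ N i j : ℕ, i ≤ j → j ≤ n → j - i ≤ 2 ^ N →
      2 * R - K ≤ f (p i) + f (p j) - d (p i) (p j) + 2 * δ * N := by
  intro N
  induction N with
  | zero =>
    intro i j hij hj hle
    have hi := hR i (hij.trans hj)
    have hj' := hR j hj
    rcases Nat.eq_or_lt_of_le hij with rfl | hlt
    · rw [hp.1]; push_cast; linarith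
    · have : j = i + 1 := by simp at hle; omega
      subst this
      have := hstep i (by omega)
      push_cast; linarith
  | succ N ih =>
    intro i j hij hj hle
    rw [pow_succ] at hle
    obtain ⟨m, hm⟩ : ∃ m, m = i + (j - i) / 2 := ⟨_, rfl⟩
    have h1 := ih i m (by omega) (by omega) (by omega)
    have h2 := ih m j (by omega) (by omega) (by omega)
    push_cast
    rcases hf (p i) (p m) (p j) with h | h <;> nlinarith

def QG (d : X → X → ℝ) (K l c : ℝ) (n : ℕ) (p : ℕ → X) : Prop :=
  ∀ i j : ℕ, i ≤ j → j ≤ n →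
    d (p i) (p j) ≤ K * ((j : ℝ) - i) ∧ (j : ℝ) - i ≤ l * d (p i) (p j) + c

theorem QG.sub {d : X → X → ℝ} {K l c : ℝ} {n : ℕ} {p : ℕ → X} (h : QG d K l c n p)
    (a m : ℕ) (ham : a + m ≤ n) : QG d K l c m (fun i => p (a + i)) := by
  intro i j hij hj
  have := h (a + i) (a + j) (by omega) (by omega)
  push_cast at this
  have e : (a : ℝ) + j - (a + i) = j - i := by ring
  rwa [e] at this

theorem aux_close {d : X → X → ℝ} {δ : ℝ} (hp : IsPseudometric d) (hδ : 0 ≤ δ)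
    (hh : GromovHyperbolic d δ) {K l c : ℝ} (hK : 0 ≤ K) {n : ℕ} {p : ℕ → X}
    (hq : QG d K l c n p) (N : ℕ) (hN : n ≤ 2 ^ N) (t : ℝ) (ht : 0 ≤ t)
    (ht' : t ≤ d (p 0) (p n)) :
    ∃ i ≤ n, d (p 0) (p i) ≤ t + (K / 2 + δ * N + 1) ∧
      d (p n) (p i) ≤ d (p 0) (p n) - t + (K / 2 + δ * N + 1) := by
  by_contra hcon
  push Not at hcon
  set f : X → ℝ := fun q => max (d (p 0) q - t) (d (p n) q - (d (p 0) (p n) - t)) with hf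
  have h1 : ∀ q, d (p 0) q - t ≤ f q := fun q => le_max_left _ _
  have h2 : ∀ q, d (p n) q - (d (p 0) (p n) - t) ≤ f q := fun q => le_max_right _ _
  have key := aux_log hp hδ f (by
    intro a b r
    rcases max_choice (d (p 0) b - t) (d (p n) b - (d (p 0) (p n) - t)) with h | h
    · have hb : f b = d (p 0) b - t := h
      rw [hb]
      have e1 := hp.2.1 b (p 0)
      have e2 := hp.2.1 r (p 0)
      have e3 := hp.2.1 a (p 0)
      rcases aux_fp hh a b r (p 0) with h' | h'
      · left; linarith [h1 r]
      · right; linarith [h1 a]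
    · have hb : f b = d (p n) b - (d (p 0) (p n) - t) := h
      rw [hb]
      have e1 := hp.2.1 b (p n)
      have e2 := hp.2.1 r (p n)
      have e3 := hp.2.1 a (p n)
      rcases aux_fp hh a b r (p n) with h' | h'
      · left; linarith [h2 r]
      · right; linarith [h2 a]) n p K (K / 2 + δ * N + 1) hK (by
    intro i hi
    by_cases hc : d (p 0) (p i) ≤ t + (K / 2 + δ * N + 1)
    · have := hcon i hi hc
      linarith [h2 (p i)]
    · push Not at hc
      linarith [h1 (p i)]) (by
    intro i hi
    have := (hq i (i + 1) (by omega) (by omega)).1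
    push_cast at this
    linarith) N 0 n (Nat.zero_le _) le_rfl (by simpa using hN)
  have f0 : f (p 0) ≤ t := by
    apply max_le
    · rw [hp.1]; linarith
    · rw [hp.2.1 (p n)]; linarith
  have fn : f (p n) ≤ d (p 0) (p n) - t := by
    apply max_le
    · linarith
    · rw [hp.1]; linarith
  linarith

theorem aux_logbound {d : X → X → ℝ} {δ : ℝ} (hp : IsPseudometric d) (hδ : 0 ≤ δ)
    (hh : GromovHyperbolic d δ) {K l c : ℝ} (hK : 0 ≤ K) (hl : 0 ≤ l) {n : ℕ} {p : ℕ → X}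
    (hq : QG d K l c n p) (N : ℕ) (hN : n ≤ 2 ^ N) (k : ℕ) (hk : k ≤ n) (h : ℝ)
    (hdef : h = K / 2 + δ * N + 1) :
    d (p 0) (p k) + d (p n) (p k) - d (p 0) (p n)
      ≤ 2 * h + 2 * K * (l * (2 * h + 1 + 2 * δ) + c) := by
  set ℓ := d (p 0) (p n) with hℓ
  have hℓ0 : 0 ≤ ℓ := aux_nonneg hp _ _
  have hh0 : 0 ≤ h := by rw [hdef]; positivity
  have hclose : ∀ t, 0 ≤ t → t ≤ ℓ → ∃ i ≤ n, d (p 0) (p i) ≤ t + h ∧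
      d (p n) (p i) ≤ ℓ - t + h := by
    intro t h0 h1
    rw [hdef]
    exact aux_close hp hδ hh hK hq N hN t h0 h1

  obtain ⟨t, i, j, hik, hkj, hjn, hi1, hi2, hj1, hj2⟩ : ∃ (t : ℝ) (i j : ℕ), i ≤ k ∧ k ≤ j ∧ j ≤ n ∧
      d (p 0) (p i) ≤ t + h ∧ d (p n) (p i) ≤ ℓ - t + h ∧
      d (p 0) (p j) ≤ t + 1 + h ∧ d (p n) (p j) ≤ ℓ - t + h := by
    classical
    have hex : ∃ m : ℕ, ∃ j, k ≤ j ∧ j ≤ n ∧ d (p 0) (p j) ≤ min (m : ℝ) ℓ + h ∧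
        d (p n) (p j) ≤ ℓ - min (m : ℝ) ℓ + h := by
      obtain ⟨m, hm⟩ := exists_nat_ge ℓ
      refine ⟨m, n, hk, le_rfl, ?_, ?_⟩
      · rw [min_eq_right hm]; linarith
      · rw [min_eq_right hm, hp.1]; linarith
    obtain ⟨j, hkj, hjn, hj1, hj2⟩ := Nat.find_spec hex
    have hmin := fun m => @Nat.find_min _ _ hex m
    generalize Nat.find hex = m at *
    rcases m with _ | m
    · refine ⟨0, 0, j, Nat.zero_le _, hkj, hjn, ?_, ?_, ?_, ?_⟩
      · rw [hp.1]; linarith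
      · rw [hp.2.1]; linarith
      · rw [Nat.cast_zero, min_eq_left hℓ0] at hj1; linarith
      · rw [Nat.cast_zero, min_eq_left hℓ0] at hj2; linarith
    · have hm := hmin m (Nat.lt_succ_self m)
      obtain ⟨i, hin, hi1, hi2⟩ := hclose (min (m : ℝ) ℓ) (le_min (Nat.cast_nonneg _) hℓ0)
        (min_le_right _ _)
      have hik : i ≤ k := by
        by_contra hc
        exact hm ⟨i, by omega, hin, hi1, hi2⟩
      have m1 : min (m : ℝ) ℓ ≤ min ((m + 1 : ℕ) : ℝ) ℓ :=
        min_le_min_right _ (by push_cast; linarith)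
      have m2 : min ((m + 1 : ℕ) : ℝ) ℓ ≤ min (m : ℝ) ℓ + 1 := by
        rw [← min_add_add_right]
        apply min_le_min
        · push_cast; linarith
        · linarith
      exact ⟨min (m : ℝ) ℓ, i, j, hik, hkj, hjn, hi1, hi2, by linarith, by linarith⟩
  have hd : d (p i) (p j) ≤ 2 * h + 1 + 2 * δ := by
    have e1 := hp.2.1 (p j) (p n)
    have e2 := hp.2.1 (p i) (p 0)
    have e3 := hp.2.1 (p i) (p n)
    rcases aux_fp hh (p i) (p 0) (p j) (p n) with h' | h' <;> linarith
  have hij := (hq i j (hik.trans hkj) hjn).2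
  have hki := (hq i k hik hk).1
  have hlm : l * d (p i) (p j) ≤ l * (2 * h + 1 + 2 * δ) := mul_le_mul_of_nonneg_left hd hl
  have hkj' : (k : ℝ) ≤ j := by exact_mod_cast hkj
  have hKm : K * ((k : ℝ) - i) ≤ K * (l * (2 * h + 1 + 2 * δ) + c) :=
    mul_le_mul_of_nonneg_left (by linarith) hK
  have t1 := hp.2.2 (p 0) (p i) (p k)
  have t2 := hp.2.2 (p n) (p i) (p k)
  linarith

theorem aux_pow (a b : ℝ) : ∃ M : ℕ, a * M + b < 2 ^ M := by
  have h1 : Tendsto (fun n : ℕ => (n : ℝ) ^ 1 / (2 : ℝ) ^ n) atTop (𝓝 0) :=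
    tendsto_pow_const_div_const_pow_of_one_lt 1 (by norm_num)
  have h2 : Tendsto (fun n : ℕ => (n : ℝ) ^ 0 / (2 : ℝ) ^ n) atTop (𝓝 0) :=
    tendsto_pow_const_div_const_pow_of_one_lt 0 (by norm_num)
  have h3 := (h1.const_mul a).add (h2.const_mul b)
  simp only [mul_zero, add_zero] at h3
  obtain ⟨M, hM⟩ := (h3.eventually (gt_mem_nhds (zero_lt_one))).exists
  refine ⟨M, ?_⟩
  have hp : (0 : ℝ) < 2 ^ M := by positivity
  have : a * ((M : ℝ) ^ 1 / 2 ^ M) + b * ((M : ℝ) ^ 0 / 2 ^ M) = (a * M + b) / 2 ^ M := by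
    field_simp
  rw [this, div_lt_one hp] at hM
  exact hM

theorem aux_morse {d : X → X → ℝ} {δ : ℝ} (hp : IsPseudometric d) (hδ : 0 ≤ δ)
    (hh : GromovHyperbolic d δ) {K l c : ℝ} (hK : 0 ≤ K) (hl : 0 ≤ l) (hc : 0 ≤ c) :
    ∃ D : ℝ, 0 ≤ D ∧ ∀ (n : ℕ) (p : ℕ → X), QG d K l c n p → ∀ k ≤ n,
      d (p 0) (p k) + d (p n) (p k) - d (p 0) (p n) ≤ D := by
  set E : ℝ → ℝ := fun h => 2 * h + 2 * K * (l * (2 * h + 1 + 2 * δ) + c) with hE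
  obtain ⟨M, hM⟩ := aux_pow (l * ((2 + 2 * K * (l * 2)) * δ))
    (l * (E (K / 2 + δ + 1) + 4 * δ) + c)
  set h : ℝ := K / 2 + δ * ((M + 1 : ℕ) : ℝ) + 1 with hhdef
  set D : ℝ := E h + 4 * δ with hD
  have hh0 : 0 ≤ h := by positivity
  have hD0 : 0 ≤ D := by simp only [hD, hE]; positivity
  have hL : l * D + c < ((2 ^ M : ℕ) : ℝ) := by
    push_cast
    refine lt_of_eq_of_lt ?_ hM
    simp only [hD, hE, hhdef]
    push_cast
    ring
  have hLN : 2 * 2 ^ M ≤ 2 ^ (M + 1) := by rw [pow_succ]; omega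
  generalize 2 ^ M = L at hL hLN
  have hfar : ∀ v, (L : ℝ) ≤ l * v + c → D < v := by
    intro v hv
    by_contra hcon
    push Not at hcon
    have := mul_le_mul_of_nonneg_left hcon hl
    linarith
  refine ⟨D, hD0, ?_⟩
  intro n
  induction n using Nat.strong_induction_on with
  | _ n ih =>
  intro p hq k hk
  rcases Nat.eq_zero_or_pos k with rfl | hk0
  · rw [hp.1, hp.2.1 (p n)]; linarith
  rcases Nat.eq_or_lt_of_le hk with rfl | hkn
  · rw [hp.1]; linarith
  obtain ⟨a, ha⟩ : ∃ a, a = k - L := ⟨_, rfl⟩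
  obtain ⟨b, hb⟩ : ∃ b, b = min (k + L) n := ⟨_, rfl⟩
  have hlog := aux_logbound hp hδ hh hK hl (hq.sub a (b - a) (by omega)) (M + 1)
    (by omega) (k - a) (by omega) h hhdef
  simp only [add_zero] at hlog
  rw [show a + (b - a) = b by omega, show a + (k - a) = k by omega] at hlog
  change _ ≤ E h at hlog
  have tri1 := hp.2.2 (p n) (p 0) (p k)
  have tri2 := hp.2.2 (p 0) (p n) (p k)
  have sy0n := hp.2.1 (p n) (p 0)
  have three : d (p a) (p k) + d (p 0) (p k) - d (p a) (p 0) ≤ D ∨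
      d (p 0) (p k) + d (p n) (p k) - d (p 0) (p n) ≤ D ∨
      d (p n) (p k) + d (p b) (p k) - d (p n) (p b) ≤ D := by
    rcases aux_fp hh (p a) (p 0) (p b) (p k) with h1 | h1
    · left; linarith
    · rcases aux_fp hh (p 0) (p n) (p b) (p k) with h2 | h2
      · right; left; linarith
      · right; right; linarith
  rcases three with h1 | h1 | h1
  · rcases Nat.le_total k L with hkL | hkL
    · have : a = 0 := by omega
      subst this
      rw [hp.1] at h1
      linarith
    · exfalso
      have h2 := ih k hkn p (by simpa using hq.sub 0 k (by omega)) a (by omega)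
      have h3 := (hq a k (by omega) hk).2
      rw [ha, Nat.cast_sub hkL, ← ha] at h3
      have h4 := hfar (d (p a) (p k)) (by linarith)
      have s1 := hp.2.1 (p k) (p a)
      have s2 := hp.2.1 (p a) (p 0)
      linarith
  · exact h1
  · rcases Nat.le_total n (k + L) with hkL | hkL
    · have : b = n := by omega
      subst this
      rw [hp.1] at h1
      linarith
    · exfalso
      have h2 := ih (n - k) (by omega) _ (hq.sub k (n - k) (by omega)) (b - k) (by omega)
      simp only [add_zero] at h2
      rw [show k + (n - k) = n by omega, show k + (b - k) = b by omega] at h2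
      have hbb : b = k + L := by omega
      have h3 := (hq k b (by omega) (by omega)).2
      rw [hbb] at h3
      push_cast at h3
      rw [← hbb] at h3
      have h4 := hfar (d (p k) (p b)) (by linarith)
      have s1 := hp.2.1 (p k) (p b)
      have s2 := hp.2.1 (p k) (p n)
      linarith

/-- Coarse intermediate value along a path. -/
theorem aux_ivt (g : ℕ → ℝ) (n : ℕ) (K t : ℝ) (h0 : g 0 ≤ t) (hn : t ≤ g n)
    (hK : 0 ≤ K) (hstep : ∀ i < n, g (i + 1) ≤ g i + K) : ∃ i ≤ n, |g i - t| ≤ K := by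
  classical
  have hex : ∃ i, t ≤ g i := ⟨n, hn⟩
  have hs := Nat.find_spec hex
  have hle : Nat.find hex ≤ n := Nat.find_le hn
  have hmin := fun m => @Nat.find_min _ _ hex m
  generalize Nat.find hex = m at *
  refine ⟨m, hle, ?_⟩
  rcases m with _ | m
  · rw [abs_le]; constructor <;> linarith
  · have := hmin m (Nat.lt_succ_self m)
    have := hstep m (by omega)
    rw [abs_le]; constructor <;> linarith

/-- Two sides crossing the bridge of a quadrilateral come uniformly close. -/
theorem aux_bridge {d : X → X → ℝ} {δ : ℝ} (hp : IsPseudometric d)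
    (hh : GromovHyperbolic d δ) {K D : ℝ} (hK : 0 ≤ K) (hδ : 0 ≤ δ) (hD : 0 ≤ D)
    (x y z w : X) (n m : ℕ) (p q : ℕ → X) (hp0 : p 0 = x) (hpn : p n = y)
    (hq0 : q 0 = w) (hqm : q m = z)
    (hps : ∀ i < n, d (p i) (p (i + 1)) ≤ K) (hqs : ∀ i < m, d (q i) (q (i + 1)) ≤ K)
    (hpD : ∀ i ≤ n, d x (p i) + d y (p i) - d x y ≤ D)
    (hqD : ∀ i ≤ m, d w (q i) + d z (q i) - d w z ≤ D)
    (hC : d y z + d x w + 2 * δ < d x z + d y w) :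
    ∃ i ≤ n, ∃ j ≤ m, d (p i) (q j) ≤ 100 * (K + D + δ) := by
  have sy := hp.2.1
  have tr := hp.2.2
  obtain ⟨i, hi, hgi⟩ := aux_ivt (fun i => d x (p i)) n K ((d y x + d w x - d y w) / 2)
    (by simp only [hp0, hp.1]; linarith [tr y x w, sy w x])
    (by simp only [hpn]; linarith [tr w y x, sy y x, sy w y]) hK
    (fun i hi => by linarith [hps i hi, tr x (p i) (p (i + 1))])
  obtain ⟨j, hj, hgj⟩ := aux_ivt (fun i => d w (q i)) m K ((d z w + d x w - d z x) / 2)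
    (by simp only [hq0, hp.1]; linarith [tr z w x, sy x w])
    (by simp only [hqm]; linarith [tr x z w, sy z w, sy x z]) hK
    (fun i hi => by linarith [hqs i hi, tr w (q i) (q (i + 1))])
  refine ⟨i, hi, j, hj, ?_⟩
  have hpi := hpD i hi
  have hqj := hqD j hj
  generalize p i = P at *
  generalize q j = Q at *
  simp only [abs_le] at hgi hgj
  obtain ⟨g1, g2⟩ := hgi
  obtain ⟨g3, g4⟩ := hgj
  have hCA : d x z + d y w ≤ d x y + d z w + 2 * δ := by
    rcases aux_fp hh x y z w with h | h <;> linarith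
  have hAC : d x y + d z w ≤ d x z + d y w + 2 * δ := by
    rcases aux_fp hh x z y w with h | h <;> linarith [sy z y, sy y w]
  rw [sy y x, sy w x] at g1 g2
  rw [sy z x] at g3 g4
  rw [sy w z] at hqj
  have hPw : d P w ≤ d x w - (d x y + d x w - d y w) / 2 + 2 * δ + 2 * K + 2 * D := by
    rcases aux_fp hh P x w y with h | h <;> linarith [sy P x, sy P y, sy w y]
  have hQx : d Q x ≤ d x w - (d z w + d x w - d x z) / 2 + 2 * δ + 2 * K + 2 * D := by
    rcases aux_fp hh Q w x z with h | h <;>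
      linarith [sy Q w, sy Q z, sy x z, sy w x, sy w z]
  rcases aux_fp hh P x Q w with h | h <;>
    linarith [sy P x, sy Q w, sy x Q, sy P w]

/-- Comparing the two metrics along a quadrilateral. -/
theorem aux_compare {d : X → X → ℝ} (hp : IsPseudometric d) (x y z w P Q : X) (D : ℝ)
    (h1 : d x P + d y P - d x y ≤ D) (h2 : d w Q + d z Q - d w z ≤ D) :
    d x z + d y w ≤ d x y + d z w + 2 * d P Q + 2 * D := by
  have sy := hp.2.1
  have tr := hp.2.2
  linarith [tr x P z, tr P Q z, tr y P w, tr P Q w, sy Q z, sy Q w, sy w z]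

/-! ### Word metrics -/

theorem wordNorm_le (S : Set G) (l : List G) (hl : ∀ s ∈ l, s ∈ S) :
    wordNorm S l.prod ≤ l.length := by
  apply Nat.sInf_le
  refine ⟨l.get, fun i => hl _ (List.get_mem _ _), ?_⟩
  rw [List.ofFn_get]

theorem exists_list (S : Set G) (hS : GenSymm S) (g : G) :
    ∃ l : List G, (∀ s ∈ l, s ∈ S) ∧ l.prod = g := by
  have hg : g ∈ Subgroup.closure S := by rw [hS.2]; trivial
  induction hg using Subgroup.closure_induction with
  | mem x hx => exact ⟨[x], by simpa using hx, by simp⟩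
  | one => exact ⟨[], by simp, by simp⟩
  | mul x y _ _ hx hy =>
    obtain ⟨l, h1, h2⟩ := hx
    obtain ⟨l', h1', h2'⟩ := hy
    refine ⟨l ++ l', ?_, by simp [h2, h2']⟩
    intro s hs
    rcases List.mem_append.1 hs with h | h
    · exact h1 s h
    · exact h1' s h
  | inv x _ hx =>
    obtain ⟨l, h1, h2⟩ := hx
    refine ⟨(l.map (fun x => x⁻¹)).reverse, ?_, by rw [← List.prod_inv_reverse, h2]⟩
    intro s hs
    simp only [List.mem_reverse, List.mem_map] at hs
    obtain ⟨a, ha, rfl⟩ := hs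
    exact hS.1 a (h1 a ha)

theorem exists_min_list (S : Set G) (hS : GenSymm S) (g : G) :
    ∃ l : List G, (∀ s ∈ l, s ∈ S) ∧ l.prod = g ∧ l.length = wordNorm S g := by
  have hne : {k : ℕ | ∃ f : Fin k → G, (∀ i, f i ∈ S) ∧ (List.ofFn f).prod = g}.Nonempty := by
    obtain ⟨l, h1, h2⟩ := exists_list S hS g
    exact ⟨l.length, l.get, fun i => h1 _ (List.get_mem _ _), by rw [List.ofFn_get, h2]⟩
  obtain ⟨f, h1, h2⟩ := Nat.sInf_mem hne
  refine ⟨List.ofFn f, ?_, h2, by rw [List.length_ofFn]; rfl⟩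
  intro s hs
  obtain ⟨i, rfl⟩ := (List.mem_ofFn' f s).1 hs
  exact h1 i

theorem wordNorm_mul (S : Set G) (hS : GenSymm S) (g h : G) :
    wordNorm S (g * h) ≤ wordNorm S g + wordNorm S h := by
  obtain ⟨l, h1, h2, h3⟩ := exists_min_list S hS g
  obtain ⟨l', h1', h2', h3'⟩ := exists_min_list S hS h
  have := wordNorm_le S (l ++ l') (by
    intro s hs
    rcases List.mem_append.1 hs with h | h
    · exact h1 s h
    · exact h1' s h)
  rw [List.prod_append, List.length_append, h2, h2', h3, h3'] at this
  exact this

theorem wordNorm_one (S : Set G) : wordNorm S (1 : G) = 0 := by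
  have := wordNorm_le S [] (by simp)
  simpa using this

/-- A word geodesic between any two points. -/
theorem exists_word_path (S : Set G) (hS : GenSymm S) (x y : G) :
    ∃ (n : ℕ) (p : ℕ → G), p 0 = x ∧ p n = y ∧
      ∀ i j : ℕ, i ≤ j → j ≤ n → wordDist S (p i) (p j) = (j : ℝ) - i := by
  obtain ⟨l, h1, h2, h3⟩ := exists_min_list S hS (x⁻¹ * y)
  refine ⟨l.length, fun i => x * (l.take i).prod, by simp, by simp [h2], ?_⟩
  intro i j hij hj
  have hmem : ∀ s ∈ (l.take j).drop i, s ∈ S := fun s hs =>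
    h1 s (List.mem_of_mem_take (List.mem_of_mem_drop hs))
  have e1 : (l.take j).prod = (l.take i).prod * ((l.take j).drop i).prod := by
    conv_lhs => rw [← List.take_append_drop i (l.take j)]
    rw [List.prod_append, List.take_take, min_eq_left hij]
  have e2 : (x * (l.take i).prod)⁻¹ * (x * (l.take j).prod) = ((l.take j).drop i).prod := by
    rw [e1]; group
  have u1 := wordNorm_le S _ hmem
  have u2 := wordNorm_le S (l.take i) (fun s hs => h1 s (List.mem_of_mem_take hs))
  have u3 := wordNorm_le S (l.drop j) (fun s hs => h1 s (List.mem_of_mem_drop hs))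
  have e3 : x⁻¹ * y = (l.take i).prod * ((l.take j).drop i).prod * (l.drop j).prod := by
    rw [← e1, ← List.prod_append, List.take_append_drop, h2]
  have u4 := wordNorm_mul S hS ((l.take i).prod * ((l.take j).drop i).prod) (l.drop j).prod
  have u5 := wordNorm_mul S hS (l.take i).prod ((l.take j).drop i).prod
  rw [← e3] at u4
  simp only [List.length_drop, List.length_take] at u1 u2 u3
  unfold wordDist
  simp only [e2]
  rw [← Nat.cast_sub hij]
  congr 1
  omega

/-- A left-invariant pseudometric is Lipschitz with respect to word metrics. -/
theorem aux_lip (S : Finset G) (hS : GenSymm (S : Set G)) (d : G → G → ℝ)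
    (h0 : ∀ x, d x x = 0) (ht : ∀ x y z, d x z ≤ d x y + d y z) (hl : LeftInvariant d) :
    ∃ M : ℝ, 0 ≤ M ∧ ∀ x y, d x y ≤ M * wordDist (S : Set G) x y := by
  have hM : ∃ M : ℝ, 0 ≤ M ∧ ∀ s ∈ S, d 1 s ≤ M := by
    refine ⟨∑ s ∈ S, |d 1 s|, Finset.sum_nonneg (fun _ _ => abs_nonneg _), ?_⟩
    intro s hs
    exact (le_abs_self _).trans
      (Finset.single_le_sum (f := fun s => |d 1 s|) (fun _ _ => abs_nonneg _) hs)
  obtain ⟨M, hM0, hM⟩ := hM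
  refine ⟨M, hM0, ?_⟩
  have hlist : ∀ l : List G, (∀ s ∈ l, s ∈ S) → d 1 l.prod ≤ M * l.length := by
    intro l
    induction l with
    | nil => intro _; simp [h0]
    | cons a l ih =>
      intro hs
      have h1 := ih (fun s h => hs s (List.mem_cons_of_mem _ h))
      have h2 := hM a (hs a List.mem_cons_self)
      have h3 := ht 1 a (a * l.prod)
      have h4 := hl a 1 l.prod
      rw [mul_one] at h4
      rw [List.prod_cons, List.length_cons]
      push_cast
      linarith
  intro x y
  obtain ⟨l, h1, h2, h3⟩ := exists_min_list (S : Set G) hS (x⁻¹ * y)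
  have h4 := hlist l (fun s hs => by simpa using h1 s hs)
  have h5 := hl x 1 (x⁻¹ * y)
  rw [mul_one, mul_inv_cancel_left] at h5
  unfold wordDist
  rw [h5, ← h3, ← h2]
  exact h4

theorem wordDist_nonneg (S : Set G) (x y : G) : 0 ≤ wordDist S x y := Nat.cast_nonneg _

theorem aux_wordlip (S T : Finset G) (hS : GenSymm (S : Set G)) (hT : GenSymm (T : Set G)) :
    ∃ M : ℝ, 0 ≤ M ∧ ∀ x y, wordDist (S : Set G) x y ≤ M * wordDist (T : Set G) x y := by
  apply aux_lip T hT
  · intro x; unfold wordDist; rw [inv_mul_cancel, wordNorm_one]; simp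
  · intro x y z
    unfold wordDist
    have := wordNorm_mul (S : Set G) hS (x⁻¹ * y) (y⁻¹ * z)
    rw [show x⁻¹ * y * (y⁻¹ * z) = x⁻¹ * z by group] at this
    exact_mod_cast this
  · intro g x y
    unfold wordDist
    rw [show (g * x)⁻¹ * (g * y) = x⁻¹ * y by group]

/-- Every `d ∈ D(G)` is comparable with the word metric of any finite generating set. -/
theorem aux_comparable (S : Finset G) (hS : GenSymm (S : Set G)) (d : G → G → ℝ) (h : InD d) :
    ∃ M l c : ℝ, 0 ≤ M ∧ 0 ≤ l ∧ 0 ≤ c ∧ ∀ x y,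
      d x y ≤ M * wordDist (S : Set G) x y ∧ wordDist (S : Set G) x y ≤ l * d x y + c := by
  obtain ⟨hp, hl, -, T, hT, l1, l2, e, hl1, hl2, he, hq⟩ := h
  obtain ⟨M, hM0, hM⟩ := aux_lip S hS d hp.1 hp.2.2 hl
  obtain ⟨A, hA0, hA⟩ := aux_wordlip S T hS hT
  refine ⟨M, A * l1, A * (l1 * e), hM0, by positivity, by positivity, ?_⟩
  intro x y
  refine ⟨hM x y, (hA x y).trans ?_⟩
  have h1 := (hq x y).1
  have h2 : wordDist (T : Set G) x y / l1 ≤ d x y + e := by linarith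
  rw [div_le_iff₀ hl1] at h2
  have := mul_le_mul_of_nonneg_left h2 hA0
  linarith

/-- One-sided main estimate. -/
theorem aux_side (S : Finset G) (hS : GenSymm (S : Set G)) (d d' : G → G → ℝ)
    (h : InD d) (h' : InD d') (δ : ℝ) (hδ : 0 ≤ δ) (hh : GromovHyperbolic d δ) :
    ∃ C : ℝ, 0 ≤ C ∧ ∀ x y z w, d y z + d x w + 2 * δ < d x z + d y w →
      d' x z + d' y w ≤ d' x y + d' z w + C := by
  obtain ⟨M, l, c, hM, hl, hc, hq⟩ := aux_comparable S hS d h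
  obtain ⟨M', l', c', hM', hl', hc', hq'⟩ := aux_comparable S hS d' h'
  obtain ⟨δ', hδ', hh'⟩ := h'.2.2.1
  obtain ⟨D, hD0, hD⟩ := aux_morse h.1 hδ hh hM hl hc
  obtain ⟨D', hD'0, hD'⟩ := aux_morse h'.1 hδ' hh' hM' hl' hc'
  refine ⟨2 * (M' * (l * (100 * (M + D + δ)) + c)) + 2 * D', by positivity, ?_⟩
  intro x y z w hC
  obtain ⟨n, p, hp0, hpn, hpW⟩ := exists_word_path (S : Set G) hS x y
  obtain ⟨m, q, hq0, hqm, hqW⟩ := exists_word_path (S : Set G) hS w z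
  have hQp : QG d M l c n p := fun i j hij hj => by
    rw [← hpW i j hij hj]; exact hq _ _
  have hQq : QG d M l c m q := fun i j hij hj => by
    rw [← hqW i j hij hj]; exact hq _ _
  have hQp' : QG d' M' l' c' n p := fun i j hij hj => by
    rw [← hpW i j hij hj]; exact hq' _ _
  have hQq' : QG d' M' l' c' m q := fun i j hij hj => by
    rw [← hqW i j hij hj]; exact hq' _ _
  obtain ⟨i, hi, j, hj, hij⟩ := aux_bridge h.1 hh hM hδ hD0 x y z w n m p q hp0 hpn hq0 hqm
    (fun i hi => by
      have := (hQp i (i + 1) (by omega) (by omega)).1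
      push_cast at this; linarith)
    (fun i hi => by
      have := (hQq i (i + 1) (by omega) (by omega)).1
      push_cast at this; linarith)
    (fun i hi => by simpa only [hp0, hpn] using hD n p hQp i hi)
    (fun i hi => by simpa only [hq0, hqm] using hD m q hQq i hi) hC
  have hcmp := aux_compare h'.1 x y z w (p i) (q j) D'
    (by simpa only [hp0, hpn] using hD' n p hQp' i hi)
    (by simpa only [hq0, hqm] using hD' m q hQq' j hj)
  have h1 := (hq' (p i) (q j)).1
  have h2 := (hq (p i) (q j)).2
  have h3 := mul_le_mul_of_nonneg_left hij hl
  have h4 := mul_le_mul_of_nonneg_left (h2.trans (add_le_add_left h3 c)) hM'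
  linarith

/-- `D(G)` is closed under pointwise sums. -/
theorem sum_mem_D (G : Type*) [Group G]
    (hG : IsHyperbolicGroup G) (hne : NonElementary G)
    (d1 d2 : G → G → ℝ) (h1 : InD d1) (h2 : InD d2) :
    InD (fun x y => d1 x y + d2 x y) := by
  obtain ⟨S, hS, l1, l2, e, hl1, hl2, he, hq⟩ := h1.2.2.2
  obtain ⟨δ1, hδ1, hh1⟩ := h1.2.2.1
  obtain ⟨δ2, hδ2, hh2⟩ := h2.2.2.1
  obtain ⟨M1, hM1, hL1⟩ := aux_lip S hS d1 h1.1.1 h1.1.2.2 h1.2.1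
  obtain ⟨M2, hM2, hL2⟩ := aux_lip S hS d2 h2.1.1 h2.1.2.2 h2.2.1
  obtain ⟨C1, hC1, hs1⟩ := aux_side S hS d1 d2 h1 h2 δ1 hδ1 hh1
  obtain ⟨C2, hC2, hs2⟩ := aux_side S hS d2 d1 h2 h1 δ2 hδ2 hh2
  refine ⟨⟨?_, ?_, ?_⟩, ?_, ⟨2 * δ1 + 2 * δ2 + C1 + C2, by positivity, ?_⟩, S, hS,
    l1, M1 + M2 + 1, e, hl1, by positivity, he, ?_⟩
  · intro x
    simp only [h1.1.1 x, h2.1.1 x, add_zero]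
  · intro x y
    simp only [h1.1.2.1 x y, h2.1.2.1 x y]
  · intro x y z
    have := h1.1.2.2 x y z
    have := h2.1.2.2 x y z
    simp only
    linarith
  · intro g x y
    simp only [h1.2.1 g x y, h2.2.1 g x y]
  · intro x y z w
    have key : d1 x z + d2 x z + (d1 y w + d2 y w) ≤
          d1 x y + d2 x y + (d1 z w + d2 z w) + 2 * (2 * δ1 + 2 * δ2 + C1 + C2) ∨
        d1 x z + d2 x z + (d1 y w + d2 y w) ≤
          d1 y z + d2 y z + (d1 x w + d2 x w) + 2 * (2 * δ1 + 2 * δ2 + C1 + C2) := by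
      by_cases c1 : d1 y z + d1 x w + 2 * δ1 < d1 x z + d1 y w
      · left
        have := hs1 x y z w c1
        rcases aux_fp hh1 x y z w with h | h <;> linarith
      · by_cases c2 : d2 y z + d2 x w + 2 * δ2 < d2 x z + d2 y w
        · left
          have := hs2 x y z w c2
          rcases aux_fp hh2 x y z w with h | h <;> linarith
        · right
          linarith
    unfold gp
    rcases key with h | h
    · refine (sub_le_sub_right (min_le_left _ _) _).trans ?_
      linarith
    · refine (sub_le_sub_right (min_le_right _ _) _).trans ?_
      linarith
  · intro x y
    have a1 := (hq x y).1
    have a2 := aux_nonneg h2.1 x y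
    have a3 := hL1 x y
    have a4 := hL2 x y
    have a5 := wordDist_nonneg (S : Set G) x y
    constructor
    · simp only; linarith
    · simp only; linarith

end
end
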